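/- There exists a set P of 8 points in ℝ³ (six points forming a regular hexagon in the xy-plane, one point above and one point below) such that for any two points p₁, p₂ ∈ ℝ³ there is a compact convex set containing at least 5 points of P but containing neither p₁ nor p₂. -/

import Mathlib

/-- Number of points of the finite set `P` lying in the set `C`. -/
noncomputable def ptsIn (P : Finset (EuclideanSpace ℝ (Fin 3)))
    (C : Set (EuclideanSpace ℝ (Fin 3))) : ℕ :=
  ((P : Set (EuclideanSpace ℝ (Fin 3))) ∩ C).ncard

def cX : Fin 8 → ℤ := ![4, 3, -1, -3, -3, 0, 0, 0]
def cY : Fin 8 → ℤ := ![1, 3, 3, 0, -4, -3, 0, 0]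
def cZ : Fin 8 → ℤ := ![0, 0, 0, 0, 0, 0, 1, -1]

noncomputable def pt (i : Fin 8) : EuclideanSpace ℝ (Fin 3) := !₂[(cX i : ℝ), (cY i : ℝ), (cZ i : ℝ)]

def InH (I : Finset (Fin 8)) (p : EuclideanSpace ℝ (Fin 3)) : Prop :=
  ∀ a b e d : ℤ, (∀ i ∈ I, a * cX i + b * cY i + e * cZ i ≤ d) →
    (a : ℝ) * p 0 + b * p 1 + e * p 2 ≤ d

lemma inH_of_mem (I : Finset (Fin 8)) (p : EuclideanSpace ℝ (Fin 3))
    (h : p ∈ convexHull ℝ (pt '' (I : Set (Fin 8)))) : InH I p := by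
  intro a b e d hI
  have hc : Convex ℝ {q : EuclideanSpace ℝ (Fin 3) | (a : ℝ) * q 0 + b * q 1 + e * q 2 ≤ d} := by
    intro u hu v hv s t hs ht hst
    simp only [Set.mem_setOf_eq, PiLp.add_apply, PiLp.smul_apply, smul_eq_mul] at *
    have : (d : ℝ) = s * d + t * d := by rw [← add_mul, hst, one_mul]
    rw [this]
    nlinarith [mul_le_mul_of_nonneg_left hu hs, mul_le_mul_of_nonneg_left hv ht]
  refine convexHull_min ?_ hc h
  rintro _ ⟨i, hi, rfl⟩
  have := hI i hi
  simp only [Set.mem_setOf_eq, pt]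
  simp
  exact_mod_cast this

lemma pt_inj : Function.Injective pt := by
  intro i j h
  have h0 : cX i = cX j := by
    have := congrArg (fun q : EuclideanSpace ℝ (Fin 3) => q 0) h
    simpa [pt] using this
  have h1 : cY i = cY j := by
    have := congrArg (fun q : EuclideanSpace ℝ (Fin 3) => q 1) h
    simpa [pt] using this
  have h2 : cZ i = cZ j := by
    have := congrArg (fun q : EuclideanSpace ℝ (Fin 3) => q 2) h
    simpa [pt] using this
  clear h
  revert i j
  decide

def Lin (a b d : ℤ) (p : EuclideanSpace ℝ (Fin 3)) : Prop := (a : ℝ) * p 0 + b * p 1 ≤ d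

lemma InH.lin {I : Finset (Fin 8)} {p : EuclideanSpace ℝ (Fin 3)} (h : InH I p) (hz : p 2 = 0)
    (e a b d : ℤ) (hd : ∀ i ∈ I, a * cX i + b * cY i + e * cZ i ≤ d) : Lin a b d p := by
  have := h a b e d hd
  rw [hz] at this
  unfold Lin
  linarith

lemma flat {p q : EuclideanSpace ℝ (Fin 3)} (hpz : p 2 = 0) (hqz : q 2 = 0)
    (H0 : ∀ I : Finset (Fin 8), I.card = 5 → InH I p ∨ InH I q) : False := by
  have get3 : ∀ (_ : True) (I : Finset (Fin 8)), I.card = 5 → ∀ (e a b d a' b' d' a'' b'' d'' : ℤ),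
      ((∀ i ∈ I, a * cX i + b * cY i + e * cZ i ≤ d) ∧
      (∀ i ∈ I, a' * cX i + b' * cY i + e * cZ i ≤ d') ∧
      (∀ i ∈ I, a'' * cX i + b'' * cY i + e * cZ i ≤ d'')) →
      (Lin a b d p ∧ Lin a' b' d' p ∧ Lin a'' b'' d'' p) ∨
      (Lin a b d q ∧ Lin a' b' d' q ∧ Lin a'' b'' d'' q) := by
    rintro _ I hI e a b d a' b' d' a'' b'' d'' ⟨h1, h2, h3⟩
    rcases H0 I hI with h | h
    · exact Or.inl ⟨h.lin hpz e _ _ _ h1, h.lin hpz e _ _ _ h2, h.lin hpz e _ _ _ h3⟩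
    · exact Or.inr ⟨h.lin hqz e _ _ _ h1, h.lin hqz e _ _ _ h2, h.lin hqz e _ _ _ h3⟩
  have H := trivial
  have T0 := get3 H {0, 1, 2, 6, 7} (by decide) (0) (1) (-4) (0) (-3) (-1) (0) (2) (1) (9) (by decide)
  have T1 := get3 H {1, 2, 3, 6, 7} (by decide) (0) (3) (-3) (0) (0) (-3) (0) (0) (4) (12) (by decide)
  have T2 := get3 H {2, 3, 4, 6, 7} (by decide) (0) (3) (1) (0) (4) (-3) (0) (-3) (2) (9) (by decide)
  have T3 := get3 H {3, 4, 5, 6, 7} (by decide) (0) (0) (3) (0) (3) (0) (0) (-4) (0) (12) (by decide)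
  have T4 := get3 H {4, 5, 0, 6, 7} (by decide) (0) (-4) (3) (0) (-1) (4) (0) (1) (-3) (9) (by decide)
  have T5 := get3 H {5, 0, 1, 6, 7} (by decide) (0) (-3) (0) (0) (-3) (3) (0) (4) (-4) (12) (by decide)
  have E0 := get3 H {4, 5, 1, 6, 7} (by decide) (0) (-4) (3) (0) (-3) (3) (0) (6) (-3) (9) (by decide)
  have E1 := get3 H {0, 2, 3, 6, 7} (by decide) (0) (1) (-4) (0) (0) (-3) (0) (2) (5) (13) (by decide)
  have E2 := get3 H {0, 1, 3, 6, 7} (by decide) (0) (1) (-4) (0) (0) (-3) (0) (-3) (6) (9) (by decide)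
  have E3 := get3 H {2, 4, 5, 6, 7} (by decide) (0) (3) (1) (0) (3) (0) (0) (-7) (2) (13) (by decide)
  have E4 := get3 H {2, 3, 5, 6, 7} (by decide) (0) (3) (1) (0) (3) (0) (0) (-3) (-3) (9) (by decide)
  have E5 := get3 H {4, 0, 1, 6, 7} (by decide) (0) (-4) (3) (0) (-3) (3) (0) (5) (-7) (13) (by decide)
  have Q0 := get3 H {0, 1, 2, 3, 6} (by decide) (-90) (1) (-7) (-3) (1) (-7) (-3) (1) (-7) (-3) (by decide)
  have Q1 := get3 H {1, 2, 3, 4, 6} (by decide) (-90) (7) (-6) (3) (7) (-6) (3) (7) (-6) (3) (by decide)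
  have Q2 := get3 H {2, 3, 4, 5, 6} (by decide) (-90) (6) (1) (-3) (6) (1) (-3) (6) (1) (-3) (by decide)
  have Q3 := get3 H {3, 4, 5, 0, 6} (by decide) (-90) (-1) (7) (3) (-1) (7) (3) (-1) (7) (3) (by decide)
  have Q4 := get3 H {4, 5, 0, 1, 6} (by decide) (-90) (-7) (6) (-3) (-7) (6) (-3) (-7) (6) (-3) (by decide)
  have Q5 := get3 H {5, 0, 1, 2, 6} (by decide) (-90) (-6) (-1) (3) (-6) (-1) (3) (-6) (-1) (3) (by decide)
  clear get3 H0
  simp only [Lin] at *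
  generalize p 0 = x at *
  generalize p 1 = y at *
  generalize q 0 = s at *
  generalize q 1 = t at *
  push_cast at *
  have hp : x = 0 → y = 0 → False := by
    rintro rfl rfl
    clear T0 T1 T2 T3 T4 T5 E0 E1 E2 E3 E4 E5 Q1 Q3 Q5
    rcases Q0 with h | h <;> rcases Q2 with h' | h' <;> rcases Q4 with h'' | h'' <;> linarith [h.1, h'.1, h''.1]
  have hq : s = 0 → t = 0 → False := by
    rintro rfl rfl
    clear T0 T1 T2 T3 T4 T5 E0 E1 E2 E3 E4 E5 Q1 Q3 Q5
    rcases Q0 with h | h <;> rcases Q2 with h' | h' <;> rcases Q4 with h'' | h'' <;> linarith [h.1, h'.1, h''.1]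
  all_goals rcases T0 with ⟨a0, b0, c0⟩ | ⟨a0, b0, c0⟩
  all_goals rcases T3 with ⟨a3, b3, c3⟩ | ⟨a3, b3, c3⟩
  all_goals try first | exact absurd (hp (by linarith) (by linarith)) id | exact absurd (hq (by linarith) (by linarith)) id
  all_goals rcases T1 with ⟨a1, b1, c1⟩ | ⟨a1, b1, c1⟩
  all_goals rcases T4 with ⟨a4, b4, c4⟩ | ⟨a4, b4, c4⟩
  all_goals try first | exact absurd (hp (by linarith) (by linarith)) id | exact absurd (hq (by linarith) (by linarith)) id
  all_goals rcases T2 with ⟨a2, b2, c2⟩ | ⟨a2, b2, c2⟩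
  all_goals rcases T5 with ⟨a5, b5, c5⟩ | ⟨a5, b5, c5⟩
  all_goals try first | exact absurd (hp (by linarith) (by linarith)) id | exact absurd (hq (by linarith) (by linarith)) id
  all_goals first
    | (rcases Q0 with ⟨d, _, _⟩ | ⟨d, _, _⟩ <;> rcases E0 with ⟨e, f, g⟩ | ⟨e, f, g⟩ <;>
        rcases E3 with ⟨l, m, n⟩ | ⟨l, m, n⟩ <;>
        first | linarith | exact hp (by linarith) (by linarith) | exact hq (by linarith) (by linarith))
    | (rcases Q4 with ⟨d, _, _⟩ | ⟨d, _, _⟩ <;> rcases E1 with ⟨e, f, g⟩ | ⟨e, f, g⟩ <;>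
        rcases E4 with ⟨l, m, n⟩ | ⟨l, m, n⟩ <;>
        first | linarith | exact hp (by linarith) (by linarith) | exact hq (by linarith) (by linarith))
    | (rcases Q2 with ⟨d, _, _⟩ | ⟨d, _, _⟩ <;> rcases E2 with ⟨e, f, g⟩ | ⟨e, f, g⟩ <;>
        rcases E5 with ⟨l, m, n⟩ | ⟨l, m, n⟩ <;>
        first | linarith | exact hp (by linarith) (by linarith) | exact hq (by linarith) (by linarith))

lemma half {p q : EuclideanSpace ℝ (Fin 3)} (k : Fin 8) (hk : 5 < k) (hpz : p 2 = 0)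
    (hqz : (cZ k : ℝ) * q 2 < 0)
    (H0 : ∀ I : Finset (Fin 8), I.card = 5 → InH I p ∨ InH I q) : False := by
  have get : ∀ (J : Finset (Fin 8)), (∀ j ∈ J, j ≤ 5) → J.card = 4 → ∀ a b d : ℤ,
      ((∀ i ∈ J, a * cX i + b * cY i ≤ d) ∧ -90 ≤ d) → Lin a b d p := by
    rintro J hJ hc a b d ⟨h1, h2⟩
    have hJz : ∀ j ∈ J, cZ j = 0 := by
      intro j hj
      have := hJ j hj
      revert this
      clear * -
      revert j
      decide
    have hkk : cX k = 0 ∧ cY k = 0 ∧ cZ k * cZ k = 1 := by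
      clear * - hk
      revert k
      decide
    have hkJ : k ∉ J := fun h => absurd (hJ k h) (not_le.mpr hk)
    rcases H0 (insert k J) (by rw [Finset.card_insert_of_notMem hkJ, hc]) with h | h
    · refine h.lin hpz (-90 * cZ k) a b d ?_
      intro i hi
      rcases Finset.mem_insert.1 hi with rfl | hi
      · rw [hkk.1, hkk.2.1]; linarith [hkk.2.2]
      · rw [hJz i hi]; linarith [h1 i hi]
    · exfalso
      have := h 0 0 (-cZ k) 0 (by
        intro i hi
        rcases Finset.mem_insert.1 hi with rfl | hi
        · linarith [hkk.2.2]
        · rw [hJz i hi]; simp)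
      push_cast at this
      linarith
  have q0 := get {0, 1, 2, 3} (by decide) (by decide) (1) (-7) (-3) (by decide)
  have q1 := get {1, 2, 3, 4} (by decide) (by decide) (7) (-6) (3) (by decide)
  have q2 := get {2, 3, 4, 5} (by decide) (by decide) (6) (1) (-3) (by decide)
  have q3 := get {3, 4, 5, 0} (by decide) (by decide) (-1) (7) (3) (by decide)
  have q4 := get {4, 5, 0, 1} (by decide) (by decide) (-7) (6) (-3) (by decide)
  have q5 := get {5, 0, 1, 2} (by decide) (by decide) (-6) (-1) (3) (by decide)
  simp only [Lin] at *
  push_cast at *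
  linarith

lemma core {p q : EuclideanSpace ℝ (Fin 3)} (hpz : p 2 = 0)
    (H0 : ∀ I : Finset (Fin 8), I.card = 5 → InH I p ∨ InH I q) : False := by
  rcases lt_trichotomy (q 2) 0 with h | h | h
  · exact half 6 (by decide) hpz (by simpa [cZ] using h) H0
  · exact flat hpz h H0
  · exact half 7 (by decide) hpz (by simpa [cZ] using h) H0

lemma hexz {p : EuclideanSpace ℝ (Fin 3)} (h : InH {0, 1, 2, 3, 4} p) : p 2 = 0 := by
  have h1 := h 0 0 1 0 (by decide)
  have h2 := h 0 0 (-1) 0 (by decide)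
  push_cast at *
  linarith

lemma filt (Q : ℝ → Prop) [DecidablePred fun p : EuclideanSpace ℝ (Fin 3) => Q (p 2)] (R : ℤ → Prop) [DecidablePred R]
    (hQR : ∀ z : ℤ, Q z ↔ R z) :
    ((Finset.univ.map ⟨pt, pt_inj⟩).filter (fun p => Q (p 2))).card =
      (Finset.univ.filter (fun i => R (cZ i))).card := by
  rw [Finset.filter_map, Finset.card_map]
  congr 1
  ext i
  simp [pt, hQR]

/-- there is an 8-point set in `ℝ³` (six points in the `xy`-plane,
one above and one below it) such that any two points miss some compact convex
set containing at least 5 points of the set. -/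
theorem lower_bound_three_dim :
    ∃ P : Finset (EuclideanSpace ℝ (Fin 3)), P.card = 8 ∧
      ((P.filter (fun p => p 2 = 0)).card = 6) ∧
      ((P.filter (fun p => p 2 > 0)).card = 1) ∧
      ((P.filter (fun p => p 2 < 0)).card = 1) ∧
      ∀ p₁ p₂ : EuclideanSpace ℝ (Fin 3),
        ∃ C : Set (EuclideanSpace ℝ (Fin 3)), IsCompact C ∧ Convex ℝ C ∧
          5 ≤ ptsIn P C ∧ p₁ ∉ C ∧ p₂ ∉ C := by
  refine ⟨Finset.univ.map ⟨pt, pt_inj⟩, by simp, ?_, ?_, ?_, ?_⟩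
  · rw [filt (fun z => z = 0) (fun z => z = 0) (by intro z; simp)]; decide
  · rw [filt (fun z => z > 0) (fun z => z > 0) (by intro z; simp)]; decide
  · rw [filt (fun z => z < 0) (fun z => z < 0) (by intro z; simp)]; decide
  intro p q
  by_contra hcon
  have H0 : ∀ I : Finset (Fin 8), I.card = 5 → InH I p ∨ InH I q := by
    intro I hI
    by_contra hn
    rw [not_or] at hn
    refine hcon ⟨convexHull ℝ (pt '' (I : Set (Fin 8))), ?_, convex_convexHull ℝ _, ?_,
      fun h => hn.1 (inH_of_mem I p h), fun h => hn.2 (inH_of_mem I q h)⟩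
    · exact Set.Finite.isCompact_convexHull ℝ ((I.finite_toSet).image pt)
    · unfold ptsIn
      rw [← hI, ← Set.ncard_coe_finset I, ← Set.ncard_image_of_injective _ pt_inj]
      apply Set.ncard_le_ncard
      · intro x hx
        refine ⟨?_, subset_convexHull ℝ _ hx⟩
        obtain ⟨i, _, rfl⟩ := hx
        simp
      · exact (Finset.finite_toSet _).subset Set.inter_subset_left
  rcases H0 {0, 1, 2, 3, 4} (by decide) with h | h
  · exact core (hexz h) H0
  · exact core (hexz h) (fun I hI => (H0 I hI).symm)
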